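/- Rank-stability is preserved by free products: let F be a field, let P_1,…,P_r ∈ F⟨x_1,…,x_d⟩ and Q_1,…,Q_s ∈ F⟨y_1,…,y_e⟩ be noncommutative polynomials, and suppose each of the two systems admits an exact solution in M_n(F) for some n ≥ 1 (i.e., each presented algebra has a finite-dimensional representation). Then the presentation F⟨x_1,…,x_d,y_1,…,y_e⟩/⟨P_1,…,P_r,Q_1,…,Q_s⟩ (which presents the free product of the two algebras) is rank-stable if and only if both presentations F⟨x_1,…,x_d⟩/⟨P_1,…,P_r⟩ and F⟨y_1,…,y_e⟩/⟨Q_1,…,Q_s⟩ are rank-stable. -/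

import Mathlib

open Matrix

noncomputable section

/-- Zero-padding of a square matrix to size `m` (the ℕ×ℕ extension `Â`, clipped to size `m`). -/
def padTo {F : Type} [Zero F] {n : ℕ} (m : ℕ) (A : Matrix (Fin n) (Fin n) F) :
    Matrix (Fin m) (Fin m) F :=
  Matrix.of fun i j =>
    if h : (i : ℕ) < n ∧ (j : ℕ) < n then A ⟨i, h.1⟩ ⟨j, h.2⟩ else 0

/-- `Rank(Â − B̂)` for `A ∈ M_n(F)` and `B ∈ M_{n'}(F)`. -/
def padRankDiff {F : Type} [Field F] {n n' : ℕ} (A : Matrix (Fin n) (Fin n) F)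
    (B : Matrix (Fin n') (Fin n') F) : ℕ :=
  (padTo (max n n') A - padTo (max n n') B).rank

/-- Evaluation of a noncommutative polynomial `P ∈ F⟨x_s : s ∈ σ⟩` at a tuple of matrices,
where scalar terms are interpreted as scalar matrices. -/
def evalPoly {F : Type} [Field F] {σ : Type} {n : ℕ}
    (P : FreeAlgebra F σ) (A : σ → Matrix (Fin n) (Fin n) F) :
    Matrix (Fin n) (Fin n) F :=
  FreeAlgebra.lift F A P

/-- Rank-stability of the presentation `F⟨x_s : s ∈ σ⟩ / ⟨P_i : i ∈ ι⟩`. -/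
def RankStable (F : Type) [Field F] {σ ι : Type} (P : ι → FreeAlgebra F σ) : Prop :=
  ∀ ε : ℝ, 0 < ε → ∃ δ : ℝ, 0 < δ ∧
    ∀ n : ℕ, 0 < n → ∀ A : σ → Matrix (Fin n) (Fin n) F,
      (∀ i, ((evalPoly (P i) A).rank : ℝ) < δ * n) →
      ∃ n' : ℕ, 0 < n' ∧ ∃ B : σ → Matrix (Fin n') (Fin n') F,
        (∀ i, evalPoly (P i) B = 0) ∧
        ∀ j, ((padRankDiff (A j) (B j) : ℝ) < ε * n)

section Padding

variable {F : Type} [Field F]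

theorem Matrix.rank_add_le {m n : Type} [Fintype m] [Fintype n]
    (A B : Matrix m n F) : (A + B).rank ≤ A.rank + B.rank := by
  unfold Matrix.rank
  rw [Matrix.mulVecLin_add]
  refine le_trans (Submodule.finrank_mono ?_)
    (Submodule.finrank_add_le_finrank_add_finrank (LinearMap.range A.mulVecLin)
      (LinearMap.range B.mulVecLin))
  rintro _ ⟨v, rfl⟩
  exact Submodule.add_mem_sup ⟨v, rfl⟩ ⟨v, rfl⟩

theorem Matrix.rank_sum_le {ι m n : Type} [Fintype m] [Fintype n]
    (s : Finset ι) (A : ι → Matrix m n F) : (∑ j ∈ s, A j).rank ≤ ∑ j ∈ s, (A j).rank := by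
  classical
  induction s using Finset.induction_on with
  | empty => simp
  | insert a s ha ih =>
    rw [Finset.sum_insert ha, Finset.sum_insert ha]
    exact (Matrix.rank_add_le _ _).trans (Nat.add_le_add_left ih _)

theorem Matrix.eq_zero_of_rank_eq_zero {m n : Type} [Fintype m] [Fintype n]
    {A : Matrix m n F} (h : A.rank = 0) : A = 0 := by
  classical
  rw [Matrix.rank, Submodule.finrank_eq_zero, LinearMap.range_eq_bot] at h
  ext i j
  simpa using congrFun (LinearMap.congr_fun h (Pi.single j 1)) i

theorem padTo_self {n : ℕ} (A : Matrix (Fin n) (Fin n) F) : padTo n A = A := by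
  ext i j
  simp [padTo]

theorem padTo_sub {n : ℕ} (m : ℕ) (A B : Matrix (Fin n) (Fin n) F) :
    padTo m (A - B) = padTo m A - padTo m B := by
  ext i j
  simp only [padTo, Matrix.of_apply, Matrix.sub_apply]
  split_ifs <;> simp

theorem padTo_padTo {n : ℕ} (k m : ℕ) (h : min n m ≤ k) (A : Matrix (Fin n) (Fin n) F) :
    padTo m (padTo k A) = padTo m A := by
  ext i j
  simp only [padTo, Matrix.of_apply]
  have hi := i.2
  have hj := j.2
  split_ifs <;> first | rfl | omega

theorem rank_padTo_le {n : ℕ} (m : ℕ) (A : Matrix (Fin n) (Fin n) F) :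
    (padTo m A).rank ≤ A.rank := by
  let J : Matrix (Fin m) (Fin n) F := Matrix.of fun i k => if (i : ℕ) = k then 1 else 0
  have hJ : padTo m A = J * A * Jᵀ := by
    ext i j
    by_cases hi : (i : ℕ) < n
    · by_cases hj : (j : ℕ) < n
      · have h1 : ∀ x : Fin n, ((i : ℕ) = x) ↔ (x = ⟨i, hi⟩) := fun x => by
          rw [Fin.ext_iff]; exact eq_comm
        have h2 : ∀ x : Fin n, ((j : ℕ) = x) ↔ (x = ⟨j, hj⟩) := fun x => by
          rw [Fin.ext_iff]; exact eq_comm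
        simp [padTo, J, Matrix.mul_apply, hi, hj, h1, h2]
      · have h2 : ∀ x : Fin n, ¬ ((j : ℕ) = x) := fun x => by omega
        simp [padTo, J, Matrix.mul_apply, hj, h2]
    · have h2 : ∀ x : Fin n, ¬ ((i : ℕ) = x) := fun x => by omega
      simp [padTo, J, Matrix.mul_apply, hi, h2]
  rw [hJ]
  exact (Matrix.rank_mul_le_left _ _).trans (Matrix.rank_mul_le_right _ _)

theorem padRankDiff_eq {n n' N : ℕ} (h : n ≤ N) (h' : n' ≤ N) (A : Matrix (Fin n) (Fin n) F)
    (B : Matrix (Fin n') (Fin n') F) :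
    padRankDiff A B = (padTo N A - padTo N B).rank := by
  have key : ∀ M M' : ℕ, n ≤ M → n' ≤ M →
      (padTo M' A - padTo M' B).rank ≤ (padTo M A - padTo M B).rank := by
    intro M M' h1 h2
    rw [← padTo_padTo M M' (by omega) A, ← padTo_padTo M M' (by omega) B, ← padTo_sub]
    exact rank_padTo_le _ _
  exact le_antisymm (key _ _ h h') (key _ _ (le_max_left _ _) (le_max_right _ _))

end Padding

section Evaluation

variable {F : Type} [Field F] {σ : Type}

theorem mul_evalPoly_of_intertwine {n m : ℕ} (P : FreeAlgebra F σ)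
    {A : σ → Matrix (Fin n) (Fin n) F} {B : σ → Matrix (Fin m) (Fin m) F}
    {T : Matrix (Fin m) (Fin n) F} (h : ∀ j, T * A j = B j * T) :
    T * evalPoly P A = evalPoly P B * T := by
  unfold evalPoly
  induction P using FreeAlgebra.induction with
  | grade0 c => simp [Algebra.algebraMap_eq_smul_one]
  | grade1 x => simpa using h x
  | mul a b ha hb =>
    rw [map_mul, map_mul, ← Matrix.mul_assoc, ha, Matrix.mul_assoc, hb, Matrix.mul_assoc]
  | add a b ha hb => rw [map_add, map_add, Matrix.mul_add, Matrix.add_mul, ha, hb]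

theorem evalPoly_zero {n : ℕ} (P : FreeAlgebra F σ) :
    evalPoly P (fun _ => (0 : Matrix (Fin n) (Fin n) F)) =
      FreeAlgebra.algebraMapInv P • (1 : Matrix (Fin n) (Fin n) F) := by
  unfold evalPoly
  induction P using FreeAlgebra.induction with
  | grade0 c => simp [Algebra.algebraMap_eq_smul_one]
  | grade1 x => simp [FreeAlgebra.algebraMapInv]
  | mul a b ha hb => simp [ha, hb, smul_smul, mul_comm]
  | add a b ha hb => simp [ha, hb, add_smul]

/-- The block-diagonal sum of two square matrices. -/
def blockSum {n m : ℕ} (A : Matrix (Fin n) (Fin n) F) (B : Matrix (Fin m) (Fin m) F) :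
    Matrix (Fin (n + m)) (Fin (n + m)) F :=
  (Matrix.fromBlocks A 0 0 B).submatrix finSumFinEquiv.symm finSumFinEquiv.symm

theorem evalPoly_blockSum {n m : ℕ} (P : FreeAlgebra F σ)
    (A : σ → Matrix (Fin n) (Fin n) F) (B : σ → Matrix (Fin m) (Fin m) F) :
    evalPoly P (fun j => blockSum (A j) (B j)) = blockSum (evalPoly P A) (evalPoly P B) := by
  unfold evalPoly blockSum
  induction P using FreeAlgebra.induction with
  | grade0 c =>
    rw [AlgHom.commutes, AlgHom.commutes, AlgHom.commutes]
    simp only [Algebra.algebraMap_eq_smul_one]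
    rw [← Matrix.submatrix_one_equiv finSumFinEquiv.symm, ← Matrix.fromBlocks_one]
    ext i j
    rcases h : finSumFinEquiv.symm i with a | a <;>
    rcases h' : finSumFinEquiv.symm j with b | b <;>
    simp only [Matrix.smul_apply, Matrix.submatrix_apply, h, h', Matrix.fromBlocks_apply₁₁,
      Matrix.fromBlocks_apply₁₂, Matrix.fromBlocks_apply₂₁, Matrix.fromBlocks_apply₂₂,
      Matrix.zero_apply, smul_zero]
  | grade1 x => simp
  | mul a b ha hb =>
    rw [map_mul, map_mul, map_mul, ha, hb, Matrix.submatrix_mul_equiv, Matrix.fromBlocks_multiply]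
    simp
  | add a b ha hb =>
    rw [map_add, map_add, map_add, ha, hb]
    ext i j
    rcases h : finSumFinEquiv.symm i with a | a <;>
    rcases h' : finSumFinEquiv.symm j with b | b <;> simp [h, h']

theorem blockSum_zero_zero {n m : ℕ} :
    blockSum (0 : Matrix (Fin n) (Fin n) F) (0 : Matrix (Fin m) (Fin m) F) = 0 := by
  simp [blockSum]

theorem rank_blockSum_zero_le {n m : ℕ} (B : Matrix (Fin m) (Fin m) F) :
    (blockSum (0 : Matrix (Fin n) (Fin n) F) B).rank ≤ m := by
  have h : (Matrix.fromBlocks (0 : Matrix (Fin n) (Fin n) F) 0 0 B) =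
      (Matrix.fromRows (0 : Matrix (Fin n) (Fin m) F) 1) *
      (Matrix.fromCols (0 : Matrix (Fin m) (Fin n) F) B) := by
    rw [Matrix.fromRows_mul_fromCols]
    simp
  unfold blockSum
  rw [Matrix.rank_submatrix, h]
  refine (Matrix.rank_mul_le_left _ _).trans ?_
  simpa using Matrix.rank_le_card_width (Matrix.fromRows (0 : Matrix (Fin n) (Fin m) F) 1)

theorem blockSum_zero {n m : ℕ} (A : Matrix (Fin n) (Fin n) F) :
    blockSum A (0 : Matrix (Fin m) (Fin m) F) = padTo (n + m) A := by
  ext i j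
  refine Fin.addCases (fun a => ?_) (fun a => ?_) i <;>
  refine Fin.addCases (fun b => ?_) (fun b => ?_) j <;>
  simp [blockSum, padTo]

theorem rank_blockSum_sub_le {n m : ℕ} (A : Matrix (Fin n) (Fin n) F)
    (B : Matrix (Fin m) (Fin m) F) :
    (padTo (n + m) A - blockSum A B).rank ≤ m := by
  have h : padTo (n + m) A - blockSum A B = blockSum 0 (-B) := by
    rw [← blockSum_zero]
    ext i j
    refine Fin.addCases (fun a => ?_) (fun a => ?_) i <;>
    refine Fin.addCases (fun b => ?_) (fun b => ?_) j <;>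
    simp [blockSum]
  rw [h]
  exact rank_blockSum_zero_le _

end Evaluation

section Compression

variable {F : Type} [Field F] {σ : Type} [Fintype σ]

/-- If `B` is a tuple of `m × m` matrices close in rank to the tuple `A` of smaller matrices, then
the joint kernel of `B` has a complement, of dimension slightly larger than `n`, containing the
first `n` coordinate vectors; `p` is the projection onto it and `i` its inclusion. -/
theorem exists_compression {n m : ℕ} (hnm : n ≤ m) (A : σ → Matrix (Fin n) (Fin n) F)
    (B : σ → Matrix (Fin m) (Fin m) F) :
    ∃ t : ℕ, t ≤ ∑ j, (padTo m (A j) - B j).rank ∧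
      ∃ (p : Matrix (Fin (n + t)) (Fin m) F) (i : Matrix (Fin m) (Fin (n + t)) F),
        p * i = 1 ∧ (∀ j, B j * i * p = B j) ∧
        ∀ X : Matrix (Fin n) (Fin n) F, p * padTo m X * i = padTo (n + t) X := by
  classical
  let v : {c : Fin m // n ≤ c} → (σ × Fin m → F) := fun c x => B x.1 x.2 c
  obtain ⟨κ, a, ha, hsp, hli⟩ := exists_linearIndependent' F v
  have : Finite κ := Finite.of_injective a ha
  obtain ⟨t, ⟨e'⟩⟩ := Finite.exists_equiv_fin κ
  let g : Fin t → {c : Fin m // n ≤ c} := a ∘ e'.symm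
  have hg : LinearIndependent F (v ∘ g) := hli.comp _ e'.symm.injective
  have hgs : Submodule.span F (Set.range (v ∘ g)) = Submodule.span F (Set.range v) := by
    rw [← hsp, ← Function.comp_assoc, Set.range_comp (v ∘ a), e'.symm.range_eq_univ,
      Set.image_univ]
  have hw : ∀ c, ∃ w : Fin t → F, ∑ b, w b • v (g b) = v c := fun c => by
    have : v c ∈ Submodule.span F (Set.range v) := Submodule.subset_span ⟨c, rfl⟩
    rw [← hgs, Submodule.mem_span_range_iff_exists_fun] at this
    exact this
  choose w hw using hw
  have hwg : ∀ b b', w (g b') b = if b = b' then 1 else 0 := by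
    intro b b'
    have h1 := hw (g b')
    have h2 : ∑ b, (w (g b') b - if b = b' then 1 else 0) • (v ∘ g) b = 0 := by
      simp only [sub_smul, Finset.sum_sub_distrib, Function.comp, h1]
      simp
    exact sub_eq_zero.mp (Fintype.linearIndependent_iff.mp hg _ h2 b)
  let G : Fin (n + t) → Fin m := Fin.addCases (fun a => Fin.castLE hnm a) (fun b => (g b).1)
  let p : Matrix (Fin (n + t)) (Fin m) F := Matrix.of fun u c =>
    Fin.addCases (motive := fun _ => F) (fun a : Fin n => if (a : ℕ) = c then 1 else 0)
      (fun b : Fin t => if h : n ≤ (c : ℕ) then w ⟨c, h⟩ b else 0) u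
  have hpl : ∀ a c, p (Fin.castAdd t a) c = if (a : ℕ) = c then 1 else 0 := fun a c => by
    simp [p]
  have hpr : ∀ b c, p (Fin.natAdd n b) c = if h : n ≤ (c : ℕ) then w ⟨c, h⟩ b else 0 :=
    fun b c => by simp [p]
  have hGl : ∀ a, G (Fin.castAdd t a) = Fin.castLE hnm a := fun a => by simp [G]
  have hGr : ∀ b, G (Fin.natAdd n b) = (g b).1 := fun b => by simp [G]
  have hX : ∀ (q : ℕ) (X : Matrix (Fin q) (Fin m) F),
      X * (1 : Matrix (Fin m) (Fin m) F).submatrix id G = X.submatrix id G := by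
    intro q X
    ext x u
    simp [Matrix.mul_apply, Matrix.one_apply]
  refine ⟨t, ?_, p, (1 : Matrix (Fin m) (Fin m) F).submatrix id G, ?_, fun j => ?_, fun X => ?_⟩
  · let V : Matrix (σ × Fin m) (Fin t) F := Matrix.of fun x b => B x.1 x.2 (g b).1
    have hV : V.rank = t := by
      have : LinearIndependent F Vᵀ.row := hg
      rw [← Matrix.rank_transpose, this.rank_matrix, Fintype.card_fin]
    have hsum : V = ∑ j, (Matrix.of fun (x : σ × Fin m) (y : Fin m) =>
        if x = (j, y) then (-1 : F) else 0) *
          (padTo m (A j) - B j).submatrix id (fun b => (g b).1) := by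
      ext ⟨j, x⟩ b
      have hb := (g b).2
      rw [Matrix.sum_apply, Finset.sum_eq_single j]
      · simp [V, Matrix.mul_apply, padTo, Nat.not_lt.mpr hb]
      · intro j' _ hj'
        simp [Matrix.mul_apply, hj'.symm]
      · simp
    calc t = V.rank := hV.symm
      _ ≤ _ := by
        rw [hsum]
        refine (Matrix.rank_sum_le _ _).trans (Finset.sum_le_sum fun j _ => ?_)
        exact (Matrix.rank_mul_le_right _ _).trans (Matrix.rank_submatrix_le _ _ _)
  · rw [hX]
    ext u u'
    refine Fin.addCases (fun a => ?_) (fun b => ?_) u <;>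
    refine Fin.addCases (fun a' => ?_) (fun b' => ?_) u'
    · simp [hpl, hGl, Matrix.one_apply, Fin.ext_iff]
    · have hb := (g b').2
      have h1 : ¬ ((a : ℕ) = (g b').1) := by omega
      have h2 : ¬ ((a : ℕ) = n + b') := by omega
      simp [hpl, hGr, Fin.ext_iff, h1, h2]
    · have h2 : ¬ (n + (b : ℕ) = a') := by omega
      simp [hpr, hGl, Fin.ext_iff, h2]
    · have hb := (g b').2
      simp [hpr, hGr, Matrix.one_apply, hb, hwg]
  · rw [hX]
    ext x c
    rw [Matrix.mul_apply, Fin.sum_univ_add]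
    simp only [Matrix.submatrix_apply, id, hpl, hpr, hGl, hGr]
    by_cases hc : n ≤ (c : ℕ)
    · have h1 : ∀ a : Fin n, ¬ ((a : ℕ) = c) := fun a => by omega
      have h2 := congrFun (hw ⟨c, hc⟩) (j, x)
      simp only [Finset.sum_apply, Pi.smul_apply, smul_eq_mul, v] at h2
      simp [h1, hc, ← h2, mul_comm]
    · have h1 : ∀ a : Fin n, ((a : ℕ) = c) ↔ a = ⟨c, by omega⟩ := fun a => by
        rw [Fin.ext_iff]
      simp [h1, hc, Fin.castLE]
  · rw [hX]
    have hl : ∀ (a : Fin n) c, (p * padTo m X) (Fin.castAdd t a) c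
        = padTo m X (Fin.castLE hnm a) c := by
      intro a c
      have h1 : ∀ x : Fin m, ((a : ℕ) = x) ↔ x = Fin.castLE hnm a := fun x => by
        rw [Fin.ext_iff]; exact eq_comm
      simp [Matrix.mul_apply, hpl, h1]
    have hr : ∀ (b : Fin t) c, (p * padTo m X) (Fin.natAdd n b) c = 0 := by
      intro b c
      rw [Matrix.mul_apply]
      refine Finset.sum_eq_zero fun x _ => ?_
      rw [hpr]
      by_cases hx : n ≤ (x : ℕ)
      · simp [padTo, Nat.not_lt.mpr hx]
      · simp [hx]
    ext u u'
    rw [Matrix.submatrix_apply]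
    refine Fin.addCases (fun a => ?_) (fun b => ?_) u
    · rw [id, hl]
      refine Fin.addCases (fun a' => ?_) (fun b' => ?_) u'
      · simp [hGl, padTo]
      · have hb := (g b').2
        simp [hGr, padTo, Nat.not_lt.mpr hb]
    · rw [id, hr]
      simp [padTo]

end Compression

theorem AddSubmonoid.exists_forall_mem_of_dvd (S : AddSubmonoid ℕ) {M : ℕ} (hM0 : 0 < M)
    (hM : M ∈ S) : ∃ c : ℕ, ∀ k ∈ S, ∀ m, c ≤ m → M ∣ k + m → m ∈ S := by
  have hf : ∀ r : ℕ, ∃ f : ℕ, (∃ x ∈ S, x % M = r) → f ∈ S ∧ f % M = r := fun r => by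
    by_cases h : ∃ x ∈ S, x % M = r
    · obtain ⟨x, hx⟩ := h
      exact ⟨x, fun _ => hx⟩
    · exact ⟨0, fun h' => absurd h' h⟩
  choose f hf using hf
  refine ⟨∑ r ∈ Finset.range M, f r, fun k hk m hm hkm => ?_⟩
  have hex : ∃ x ∈ S, x % M = m % M := by
    refine ⟨(M - 1) * k, by simpa using S.nsmul_mem hk (M - 1), ?_⟩
    have h1 : (k + (M - 1) * k) = M * k := by
      obtain ⟨M, rfl⟩ := Nat.exists_eq_succ_of_ne_zero hM0.ne'
      simp only [Nat.succ_eq_add_one, Nat.add_sub_cancel]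
      ring
    have h2 : k + (M - 1) * k ≡ k + m [MOD M] := by
      rw [h1]
      exact ((Nat.modEq_zero_iff_dvd.mpr ⟨k, rfl⟩).trans
        (Nat.modEq_zero_iff_dvd.mpr hkm).symm)
    exact Nat.ModEq.add_left_cancel' k h2
  obtain ⟨hfS, hfm⟩ := hf _ hex
  have hle : f (m % M) ≤ m :=
    (Finset.single_le_sum (f := f) (fun _ _ => Nat.zero_le _)
      (Finset.mem_range.mpr (Nat.mod_lt m hM0))).trans hm
  obtain ⟨q, hq⟩ := (Nat.modEq_iff_dvd' hle).mp hfm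
  have : m = f (m % M) + q • M := by
    rw [smul_eq_mul, mul_comm]; omega
  rw [this]
  exact S.add_mem hfS (S.nsmul_mem hM q)

section Stability

variable {F : Type} [Field F] {σ ι τ κ : Type}

/-- The sizes in which the system `P` has an exact solution. -/
def solutionSizes (P : ι → FreeAlgebra F σ) : AddSubmonoid ℕ where
  carrier := {m | ∃ B : σ → Matrix (Fin m) (Fin m) F, ∀ i, evalPoly (P i) B = 0}
  zero_mem' := ⟨fun _ => 0, fun _ => Subsingleton.elim _ _⟩
  add_mem' := by
    rintro a b ⟨A, hA⟩ ⟨B, hB⟩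
    refine ⟨fun j => blockSum (A j) (B j), fun i => ?_⟩
    rw [evalPoly_blockSum, hA, hB, blockSum_zero_zero]

theorem padRankDiff_comm {n m : ℕ} (A : Matrix (Fin n) (Fin n) F)
    (B : Matrix (Fin m) (Fin m) F) : padRankDiff A B = padRankDiff B A := by
  have key : ∀ X Y : Matrix (Fin (max n m)) (Fin (max n m)) F, (X - Y).rank ≤ (Y - X).rank := by
    intro X Y
    have : X - Y = (Y - X) * (-1) := by simp
    rw [this]
    exact Matrix.rank_mul_le_left _ _
  rw [padRankDiff_eq (le_max_right n m) (le_max_left n m) B A]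
  exact le_antisymm (key _ _) (key _ _)

theorem padRankDiff_blockSum_le {n k m : ℕ} (h : n ≤ k + m) (A : Matrix (Fin n) (Fin n) F)
    (B : Matrix (Fin k) (Fin k) F) (C : Matrix (Fin m) (Fin m) F) :
    padRankDiff A (blockSum B C) ≤ padRankDiff A B + m := by
  rw [padRankDiff_eq h le_rfl, padRankDiff_eq h (Nat.le_add_right k m), padTo_self,
    ← sub_add_sub_cancel _ (padTo (k + m) B)]
  exact (Matrix.rank_add_le _ _).trans (Nat.add_le_add_left (rank_blockSum_sub_le _ _) _)

theorem padRankDiff_blockSum_zero {n k m : ℕ} (h : n ≤ k + m) (A : Matrix (Fin n) (Fin n) F)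
    (B : Matrix (Fin k) (Fin k) F) :
    padRankDiff A (blockSum B (0 : Matrix (Fin m) (Fin m) F)) = padRankDiff A B := by
  rw [padRankDiff_eq h le_rfl, padRankDiff_eq h (Nat.le_add_right k m), padTo_self, blockSum_zero]

/-- A solution larger than the approximate solution can be shrunk to nearly the same size. -/
theorem exists_smaller_solution [Fintype σ] {P : ι → FreeAlgebra F σ} {n m : ℕ} (hnm : n ≤ m)
    (A : σ → Matrix (Fin n) (Fin n) F) (B : σ → Matrix (Fin m) (Fin m) F)
    (hB : ∀ i, evalPoly (P i) B = 0) :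
    ∃ t, t ≤ ∑ j, padRankDiff (A j) (B j) ∧
      ∃ B' : σ → Matrix (Fin (n + t)) (Fin (n + t)) F, (∀ i, evalPoly (P i) B' = 0) ∧
        ∀ j, padRankDiff (A j) (B' j) ≤ padRankDiff (A j) (B j) := by
  obtain ⟨t, ht, p, q, hpq, hB', hX⟩ := exists_compression hnm A B
  have hd : ∀ j, padRankDiff (A j) (B j) = (padTo m (A j) - B j).rank := fun j => by
    rw [padRankDiff_eq hnm le_rfl, padTo_self]
  refine ⟨t, by simpa only [hd] using ht, fun j => p * B j * q, fun i => ?_, fun j => ?_⟩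
  · have h := mul_evalPoly_of_intertwine (P i) (A := B) (B := fun j => p * B j * q) (T := p)
      (fun j => by rw [Matrix.mul_assoc, Matrix.mul_assoc, ← Matrix.mul_assoc (B j), hB'])
    rw [hB, Matrix.mul_zero] at h
    rw [← Matrix.mul_one (evalPoly (P i) fun j => p * B j * q), ← hpq, ← Matrix.mul_assoc, ← h,
      Matrix.zero_mul]
  · rw [hd, padRankDiff_eq (Nat.le_add_right n t) le_rfl, padTo_self, ← hX, ← Matrix.sub_mul,
      ← Matrix.mul_sub]
    exact (Matrix.rank_mul_le_left _ _).trans (Matrix.rank_mul_le_right _ _)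

/-- A polynomial with nonzero constant term has large rank on a tuple close in rank to a tuple of
much smaller matrices. -/
theorem size_le_of_algebraMapInv_ne_zero [Fintype σ] {P : FreeAlgebra F σ}
    (hP : FreeAlgebra.algebraMapInv P ≠ 0) {n m : ℕ} (hmn : m ≤ n)
    (A : σ → Matrix (Fin n) (Fin n) F) (B : σ → Matrix (Fin m) (Fin m) F) :
    n ≤ (evalPoly P A).rank + (m + ∑ j, padRankDiff (A j) (B j)) := by
  obtain ⟨t, ht, p, q, -, hA, -⟩ := exists_compression hmn B A
  have hd : ∀ j, padRankDiff (A j) (B j) = (padTo n (B j) - A j).rank := fun j => by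
    rw [padRankDiff_comm, padRankDiff_eq hmn le_rfl, padTo_self]
  simp only [hd]
  have h := mul_evalPoly_of_intertwine P (A := fun _ => (0 : Matrix (Fin n) (Fin n) F)) (B := A)
    (T := 1 - q * p) (fun j => by
      rw [Matrix.mul_zero, Matrix.mul_sub, ← Matrix.mul_assoc, hA, Matrix.mul_one, sub_self])
  rw [evalPoly_zero, Matrix.mul_smul, Matrix.mul_one] at h
  have h1 : (1 - q * p).rank ≤ (evalPoly P A).rank := by
    have : 1 - q * p =
        evalPoly P A * ((FreeAlgebra.algebraMapInv P)⁻¹ • (1 - q * p)) := by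
      rw [Matrix.mul_smul, ← h, smul_smul, inv_mul_cancel₀ hP, one_smul]
    rw [this]
    exact Matrix.rank_mul_le_left _ _
  have h2 : (q * p).rank ≤ m + t :=
    (Matrix.rank_mul_le_right _ _).trans (Matrix.rank_le_height _)
  have h3 := Matrix.rank_add_le (1 - q * p) (q * p)
  rw [sub_add_cancel, Matrix.rank_one, Fintype.card_fin] at h3
  omega

theorem RankStable.exists_solution_of_controlled_size [Fintype σ] {P : ι → FreeAlgebra F σ}
    (hP : RankStable F P) {ε : ℝ} (hε : 0 < ε) :
    ∃ δ : ℝ, 0 < δ ∧ ∀ n : ℕ, 0 < n → ∀ A : σ → Matrix (Fin n) (Fin n) F,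
      (∀ i, ((evalPoly (P i) A).rank : ℝ) < δ * n) →
      ∃ k : ℕ, (k : ℝ) ≤ (1 + ε) * n ∧
        ((∀ i, FreeAlgebra.algebraMapInv (P i) = 0) ∨ (1 - 2 * ε) * n ≤ k) ∧
        ∃ B : σ → Matrix (Fin k) (Fin k) F, (∀ i, evalPoly (P i) B = 0) ∧
          ∀ j, (padRankDiff (A j) (B j) : ℝ) < ε * n := by
  set d : ℝ := (Fintype.card σ : ℝ) with hd
  have hd0 : 0 ≤ d := Nat.cast_nonneg _
  set ε' := ε / (d + 1) with hε'
  have hε'0 : 0 < ε' := by positivity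
  have hε'ε : (d + 1) * ε' = ε := by rw [hε']; field_simp
  obtain ⟨δ, hδ, H⟩ := hP ε' hε'0
  refine ⟨min δ ε, lt_min hδ hε, fun n hn A hA => ?_⟩
  have hn' : (0 : ℝ) < n := Nat.cast_pos.mpr hn
  obtain ⟨m, hm, B, hB, hAB⟩ := H n hn A fun i =>
    (hA i).trans_le (mul_le_mul_of_nonneg_right (min_le_left _ _) hn'.le)
  have hε'n : 0 < ε' * n := by positivity
  have hdε'n : 0 ≤ d * (ε' * n) := by positivity
  have hεn : ε * n = d * (ε' * n) + ε' * n := by rw [← hε'ε]; ring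
  have hsum : ((∑ j, padRankDiff (A j) (B j) : ℕ) : ℝ) ≤ d * (ε' * n) := by
    rw [Nat.cast_sum]
    refine (Finset.sum_le_sum fun j _ => (hAB j).le).trans ?_
    simp [hd]
  rcases le_total n m with hnm | hmn
  · obtain ⟨t, ht, B', hB', hAB'⟩ := exists_smaller_solution hnm A B hB
    have ht' : (t : ℝ) ≤ d * (ε' * n) := le_trans (Nat.cast_le.mpr ht) hsum
    have ht0 : (0 : ℝ) ≤ t := Nat.cast_nonneg _
    refine ⟨n + t, by push_cast; linarith, Or.inr (by push_cast; linarith), B', hB', fun j => ?_⟩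
    have := hAB j
    have : (padRankDiff (A j) (B' j) : ℝ) ≤ padRankDiff (A j) (B j) := Nat.cast_le.mpr (hAB' j)
    linarith
  · have hmn' : (m : ℝ) ≤ n := Nat.cast_le.mpr hmn
    refine ⟨m, by linarith, ?_, B, hB, fun j => by linarith [hAB j]⟩
    by_cases h0 : ∀ i, FreeAlgebra.algebraMapInv (P i) = 0
    · exact Or.inl h0
    · push Not at h0
      obtain ⟨i, hi⟩ := h0
      have h1 : (n : ℝ) ≤ (evalPoly (P i) A).rank + (m + (∑ j, padRankDiff (A j) (B j) : ℕ)) := by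
        exact_mod_cast size_le_of_algebraMapInv_ne_zero hi hmn A B
      have h2 : ((evalPoly (P i) A).rank : ℝ) < ε * n :=
        (hA i).trans_le (mul_le_mul_of_nonneg_right (min_le_right _ _) hn'.le)
      right
      linarith

theorem RankStable.exists_solution_of_size [Fintype σ] {P : ι → FreeAlgebra F σ}
    (hP : RankStable F P) {M : ℕ} (hM0 : 0 < M) (hM : M ∈ solutionSizes P) {ε : ℝ} (hε : 0 < ε) :
    ∃ δ : ℝ, 0 < δ ∧ ∃ n₀ : ℕ, ∀ n : ℕ, 0 < n → n₀ ≤ n → ∀ A : σ → Matrix (Fin n) (Fin n) F,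
      (∀ i, ((evalPoly (P i) A).rank : ℝ) < δ * n) →
      ∀ N : ℕ, M ∣ N → (1 + ε) * n ≤ N → (N : ℝ) ≤ (1 + 2 * ε) * n →
      ∃ B : σ → Matrix (Fin N) (Fin N) F, (∀ i, evalPoly (P i) B = 0) ∧
        ∀ j, (padRankDiff (A j) (B j) : ℝ) < 5 * ε * n := by
  obtain ⟨c, hc⟩ := (solutionSizes P).exists_forall_mem_of_dvd hM0 hM
  obtain ⟨δ, hδ, H⟩ := hP.exists_solution_of_controlled_size (half_pos hε)
  obtain ⟨n₀, hn₀⟩ := exists_nat_ge (c / (ε / 2))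
  refine ⟨δ, hδ, n₀, fun n hn hnn A hA N hMN hN₁ hN₂ => ?_⟩
  have hn' : (0 : ℝ) < n := Nat.cast_pos.mpr hn
  have hεn : 0 < ε * n := by positivity
  have hcn : (c : ℝ) ≤ ε / 2 * n := by
    rw [div_le_iff₀ (by positivity)] at hn₀
    have : (n₀ : ℝ) ≤ n := Nat.cast_le.mpr hnn
    nlinarith
  obtain ⟨k, hk, hk', B, hB, hAB⟩ := H n hn A hA
  have hkN : k ≤ N := by
    have : (k : ℝ) ≤ N := by linarith
    exact_mod_cast this
  have hnN : n ≤ N := by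
    have : (n : ℝ) ≤ N := by linarith
    exact_mod_cast this
  obtain ⟨m, rfl⟩ := Nat.exists_eq_add_of_le hkN
  rcases hk' with h0 | hk'
  · refine ⟨fun j => blockSum (B j) 0, fun i => ?_, fun j => ?_⟩
    · rw [evalPoly_blockSum, hB, evalPoly_zero, h0, zero_smul, blockSum_zero_zero]
    · rw [padRankDiff_blockSum_zero hnN]
      linarith [hAB j]
  · push_cast at hN₁ hN₂
    have hcm : c ≤ m := by
      have : (c : ℝ) ≤ m := by linarith
      exact_mod_cast this
    obtain ⟨C, hC⟩ := hc k ⟨B, hB⟩ m hcm hMN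
    refine ⟨fun j => blockSum (B j) (C j), fun i => ?_, fun j => ?_⟩
    · rw [evalPoly_blockSum, hB, hC, blockSum_zero_zero]
    · have : (padRankDiff (A j) (blockSum (B j) (C j)) : ℝ) ≤ padRankDiff (A j) (B j) + m := by
        exact_mod_cast padRankDiff_blockSum_le hnN (A j) (B j) (C j)
      linarith [hAB j]

/-- Simultaneous rank-stability of two systems in disjoint sets of variables. -/
def JointlyRankStable (P : ι → FreeAlgebra F σ) (Q : κ → FreeAlgebra F τ) : Prop :=
  ∀ ε : ℝ, 0 < ε → ∃ δ : ℝ, 0 < δ ∧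
    ∀ n : ℕ, 0 < n → ∀ (A : σ → Matrix (Fin n) (Fin n) F) (C : τ → Matrix (Fin n) (Fin n) F),
      (∀ i, ((evalPoly (P i) A).rank : ℝ) < δ * n) →
      (∀ i, ((evalPoly (Q i) C).rank : ℝ) < δ * n) →
      ∃ n' : ℕ, 0 < n' ∧ ∃ (B : σ → Matrix (Fin n') (Fin n') F)
        (D : τ → Matrix (Fin n') (Fin n') F),
        ((∀ i, evalPoly (P i) B = 0) ∧ ∀ j, (padRankDiff (A j) (B j) : ℝ) < ε * n) ∧
        ((∀ i, evalPoly (Q i) D = 0) ∧ ∀ j, (padRankDiff (C j) (D j) : ℝ) < ε * n)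

theorem JointlyRankStable.symm {P : ι → FreeAlgebra F σ} {Q : κ → FreeAlgebra F τ}
    (h : JointlyRankStable P Q) : JointlyRankStable Q P := by
  intro ε hε
  obtain ⟨δ, hδ, H⟩ := h ε hε
  refine ⟨δ, hδ, fun n hn A C hA hC => ?_⟩
  obtain ⟨n', hn', B, D, hB, hD⟩ := H n hn C A hC hA
  exact ⟨n', hn', D, B, hD, hB⟩

theorem evalPoly_lift_ι {n : ℕ} (f : σ → τ) (P : FreeAlgebra F σ)
    (A : τ → Matrix (Fin n) (Fin n) F) :
    evalPoly (FreeAlgebra.lift F (fun k => FreeAlgebra.ι F (f k)) P) A =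
      evalPoly P (fun k => A (f k)) := by
  unfold evalPoly
  rw [← AlgHom.comp_apply]
  congr 1
  ext k
  simp

theorem rankStable_sumElim_iff {P : ι → FreeAlgebra F σ} {Q : κ → FreeAlgebra F τ} :
    RankStable F
      (Sum.elim
        (fun i => FreeAlgebra.lift F (fun k => FreeAlgebra.ι F (Sum.inl k : σ ⊕ τ)) (P i))
        (fun i => FreeAlgebra.lift F (fun k => FreeAlgebra.ι F (Sum.inr k : σ ⊕ τ)) (Q i))) ↔
      JointlyRankStable P Q := by
  refine forall₂_congr fun ε _ => exists_congr fun δ => and_congr_right fun _ =>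
    forall₂_congr fun n _ => ⟨fun H A C hA hC => ?_, fun H A hA => ?_⟩
  · obtain ⟨n', hn', B, hB, hAB⟩ := H (Sum.elim A C) (by
      rintro (i | i)
      · simpa [evalPoly_lift_ι] using hA i
      · simpa [evalPoly_lift_ι] using hC i)
    refine ⟨n', hn', fun k => B (Sum.inl k), fun k => B (Sum.inr k),
      ⟨fun i => ?_, fun j => hAB (Sum.inl j)⟩, ⟨fun i => ?_, fun j => hAB (Sum.inr j)⟩⟩
    · simpa [evalPoly_lift_ι] using hB (Sum.inl i)
    · simpa [evalPoly_lift_ι] using hB (Sum.inr i)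
  · obtain ⟨n', hn', B, D, ⟨hB, hAB⟩, hD, hCD⟩ := H (fun k => A (Sum.inl k))
      (fun k => A (Sum.inr k))
      (fun i => by simpa [evalPoly_lift_ι] using hA (Sum.inl i))
      (fun i => by simpa [evalPoly_lift_ι] using hA (Sum.inr i))
    refine ⟨n', hn', Sum.elim B D, ?_, ?_⟩
    · rintro (i | i)
      · simpa [evalPoly_lift_ι] using hB i
      · simpa [evalPoly_lift_ι] using hD i
    · rintro (j | j)
      · exact hAB j
      · exact hCD j

theorem padRankDiff_self {n : ℕ} (A : Matrix (Fin n) (Fin n) F) : padRankDiff A A = 0 := by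
  simp [padRankDiff]

/-- If the relative rank tolerance is at most `1 / n`, an approximate solution is exact. -/
theorem evalPoly_eq_zero_of_rank_lt {P : ι → FreeAlgebra F σ} {n : ℕ} {δ : ℝ} (hδ : δ * n ≤ 1)
    {A : σ → Matrix (Fin n) (Fin n) F} (hA : ∀ i, ((evalPoly (P i) A).rank : ℝ) < δ * n) (i : ι) :
    evalPoly (P i) A = 0 := by
  have h : (evalPoly (P i) A).rank < 1 := by exact_mod_cast (hA i).trans_le hδ
  exact Matrix.eq_zero_of_rank_eq_zero (by omega)

theorem JointlyRankStable.left {P : ι → FreeAlgebra F σ} {Q : κ → FreeAlgebra F τ}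
    (h : JointlyRankStable P Q) {b : ℕ} (hb : 0 < b) (hQ : b ∈ solutionSizes Q) :
    RankStable F P := by
  intro ε hε
  obtain ⟨δ, hδ, H⟩ := h ε hε
  have hb' : (0 : ℝ) < b := Nat.cast_pos.mpr hb
  refine ⟨min δ (δ / b), by positivity, fun n hn A hA => ?_⟩
  have hn' : (0 : ℝ) < n := Nat.cast_pos.mpr hn
  by_cases hbn : δ * n ≤ b
  · refine ⟨n, hn, A, evalPoly_eq_zero_of_rank_lt (?_ : min δ (δ / b) * n ≤ 1) hA, fun j => ?_⟩
    · calc min δ (δ / b) * n ≤ δ / b * n := by gcongr; exact min_le_right _ _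
        _ = δ * n / b := by ring
        _ ≤ 1 := (div_le_one hb').mpr hbn
    · rw [padRankDiff_self, Nat.cast_zero]
      positivity
  · push Not at hbn
    obtain ⟨q, m, hm, rfl⟩ : ∃ q m, m < b ∧ n = q • b + m :=
      ⟨n / b, n % b, Nat.mod_lt n hb, by rw [smul_eq_mul, mul_comm, Nat.div_add_mod]⟩
    obtain ⟨C, hC⟩ := (solutionSizes Q).nsmul_mem hQ q
    obtain ⟨n', hn', B, -, hB, -⟩ := H _ hn A (fun j => blockSum (C j) (0 : Matrix (Fin m) _ F))
      (fun i => (hA i).trans_le (by gcongr; exact min_le_left _ _)) (fun i => by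
        rw [evalPoly_blockSum, hC]
        refine lt_trans ?_ hbn
        exact_mod_cast (rank_blockSum_zero_le (n := q • b) (evalPoly (Q i) fun _ => 0)).trans_lt hm)
    exact ⟨n', hn', B, hB⟩

theorem JointlyRankStable.of_rankStable [Fintype σ] [Fintype τ] {P : ι → FreeAlgebra F σ}
    {Q : κ → FreeAlgebra F τ} (hP : RankStable F P) (hQ : RankStable F Q) {M : ℕ} (hM : 0 < M)
    (hMP : M ∈ solutionSizes P) (hMQ : M ∈ solutionSizes Q) : JointlyRankStable P Q := by
  intro ε hε
  set η := ε / 5 with hη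
  have hη0 : 0 < η := by positivity
  have hηε : 5 * η = ε := by rw [hη]; ring
  obtain ⟨δ₁, hδ₁, n₁, H₁⟩ := hP.exists_solution_of_size hM hMP hη0
  obtain ⟨δ₂, hδ₂, n₂, H₂⟩ := hQ.exists_solution_of_size hM hMQ hη0
  obtain ⟨n₃, hn₃⟩ := exists_nat_ge (M / η)
  rw [div_le_iff₀ hη0] at hn₃
  set n₀ := n₁ + n₂ + n₃ with hn₀
  have hn₀' : (0 : ℝ) < n₀ + 1 := by positivity
  refine ⟨min (min δ₁ δ₂) (1 / (n₀ + 1)), by positivity, fun n hn A C hA hC => ?_⟩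
  have hn' : (0 : ℝ) < n := Nat.cast_pos.mpr hn
  rcases lt_or_ge n n₀ with hlt | hge
  · have hδn : min (min δ₁ δ₂) (1 / ((n₀ : ℝ) + 1)) * n ≤ 1 := by
      have : (n : ℝ) ≤ n₀ := Nat.cast_le.mpr hlt.le
      calc _ ≤ 1 / ((n₀ : ℝ) + 1) * n := by gcongr; exact min_le_right _ _
        _ = n / ((n₀ : ℝ) + 1) := by ring
        _ ≤ 1 := (div_le_one hn₀').mpr (by linarith)
    refine ⟨n, hn, A, C, ⟨evalPoly_eq_zero_of_rank_lt hδn hA, fun j => ?_⟩,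
      evalPoly_eq_zero_of_rank_lt hδn hC, fun j => ?_⟩ <;>
    · rw [padRankDiff_self, Nat.cast_zero]
      positivity
  · have hM' : (M : ℝ) ≤ η * n := by
      have : (n₃ : ℝ) ≤ n := Nat.cast_le.mpr (by omega)
      nlinarith
    have hx : 0 ≤ (1 + η) * n / M := by positivity
    have hMpos : (0 : ℝ) < M := Nat.cast_pos.mpr hM
    set N := M * ⌈(1 + η) * n / M⌉₊ with hN
    have hN₁ : (1 + η) * n ≤ (N : ℝ) := by
      have := Nat.le_ceil ((1 + η) * n / M)
      rw [div_le_iff₀ hMpos] at this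
      rw [hN]
      push_cast
      linarith
    have hN₂ : (N : ℝ) ≤ (1 + 2 * η) * n := by
      have := mul_lt_mul_of_pos_left (Nat.ceil_lt_add_one hx) hMpos
      rw [mul_add, mul_div_cancel₀ _ hMpos.ne'] at this
      rw [hN]
      push_cast
      linarith
    have hN0 : 0 < N := by
      have : (0 : ℝ) < N := lt_of_lt_of_le (by positivity) hN₁
      exact_mod_cast this
    obtain ⟨B, hB, hAB⟩ := H₁ n hn (by omega) A (fun i => (hA i).trans_le (by
      gcongr; exact (min_le_left _ _).trans (min_le_left _ _))) N ⟨_, rfl⟩ hN₁ hN₂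
    obtain ⟨D, hD, hCD⟩ := H₂ n hn (by omega) C (fun i => (hC i).trans_le (by
      gcongr; exact (min_le_left _ _).trans (min_le_right _ _))) N ⟨_, rfl⟩ hN₁ hN₂
    rw [hηε] at hAB hCD
    exact ⟨N, hN0, B, D, ⟨hB, hAB⟩, hD, hCD⟩

end Stability

/-- **Free products preserve rank-stability.** Suppose the systems `P` (in `d` variables) and
`Q` (in `e` variables) each admit an exact solution by matrices of some positive size. Then
the presentation `F⟨x_1,…,x_d,y_1,…,y_e⟩/⟨P_1,…,P_r,Q_1,…,Q_s⟩` of the free product is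
rank-stable if and only if both `F⟨x⟩/⟨P⟩` and `F⟨y⟩/⟨Q⟩` are rank-stable. -/
theorem stmt3_free_product_rank_stable_iff
    (F : Type) [Field F] (d e r s : ℕ)
    (P : Fin r → FreeAlgebra F (Fin d)) (Q : Fin s → FreeAlgebra F (Fin e))
    (hPrep : ∃ n : ℕ, 0 < n ∧ ∃ A : Fin d → Matrix (Fin n) (Fin n) F,
      ∀ i, evalPoly (P i) A = 0)
    (hQrep : ∃ n : ℕ, 0 < n ∧ ∃ B : Fin e → Matrix (Fin n) (Fin n) F,
      ∀ j, evalPoly (Q j) B = 0) :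
    RankStable F
      (Sum.elim
        (fun i => FreeAlgebra.lift F
          (fun k : Fin d => FreeAlgebra.ι F (Sum.inl k : Fin d ⊕ Fin e)) (P i))
        (fun j => FreeAlgebra.lift F
          (fun k : Fin e => FreeAlgebra.ι F (Sum.inr k : Fin d ⊕ Fin e)) (Q j))
        : Fin r ⊕ Fin s → FreeAlgebra F (Fin d ⊕ Fin e))
      ↔ (RankStable F P ∧ RankStable F Q) := by
  rw [rankStable_sumElim_iff]
  obtain ⟨a, ha, hPa⟩ := hPrep
  obtain ⟨b, hb, hQb⟩ := hQrep
  refine ⟨fun h => ⟨h.left hb hQb, h.symm.left ha hPa⟩, fun h => ?_⟩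
  refine JointlyRankStable.of_rankStable h.1 h.2 (Nat.mul_pos ha hb) ?_ ?_
  · rw [mul_comm]
    exact (solutionSizes P).nsmul_mem hPa b
  · exact (solutionSizes Q).nsmul_mem hQb a
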